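/- arXiv:1005.4284 — 2 statements merged into one kernel-verified Lean document; each statement's English description precedes it below -/
import Mathlib

section
/- Let A be a finite group of odd order acting by automorphisms on a finite 2-group P, and let D ≤ P with 1 < |D| < |P|. If every subgroup of P of order |D| (and also every subgroup of order 4 in case |D| = 2) is A-invariant, then A acts trivially on P. -/
theorem aux_between {P : Type*} [Group P] [Finite P] (H K : Subgroup P) (n k m : ℕ)
    (hHK : H ≤ K) (hH : Nat.card H = 2 ^ n) (hK : Nat.card K = 2 ^ m) (hnk : n ≤ k)
    (hkm : k ≤ m) : ∃ M : Subgroup P, H ≤ M ∧ M ≤ K ∧ Nat.card M = 2 ^ k := by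
  have : Fact (Nat.Prime 2) := ⟨Nat.prime_two⟩
  have h1 : Nat.card (H.subgroupOf K) = 2 ^ n := by
    rw [← hH]; exact Nat.card_congr (Subgroup.subgroupOfEquivOfLe hHK).toEquiv
  obtain ⟨M, hM, hle⟩ := Sylow.exists_subgroup_card_pow_prime_le (G := K) 2
    (by rw [hK]; exact pow_dvd_pow 2 hkm) (H.subgroupOf K) h1 hnk
  refine ⟨M.map K.subtype, ?_, ?_, ?_⟩
  · intro x hx
    exact ⟨⟨x, hHK hx⟩, hle (by simpa [Subgroup.mem_subgroupOf] using hx), rfl⟩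
  · rintro _ ⟨y, _, rfl⟩; exact y.2
  · rw [← hM]
    exact Subgroup.card_map_of_injective K.subtype_injective

theorem aux_pow_mem {P : Type*} [Group P] (α : MulAut P) (x y : P) (h1 : α x = x * y)
    (h2 : α y = y) (n : ℕ) : (α ^ n) x = x * y ^ n := by
  induction n with
  | zero => simp
  | succ k ih =>
    rw [pow_succ', MulAut.mul_apply, ih, map_mul, map_pow, h1, h2, mul_assoc, pow_succ']

theorem aux_odd_four {P : Type*} [Group P] (y : P) (n : ℕ) (hn : Odd n) (h4 : y ^ 4 = 1)
    (h : y ^ n = 1) : y = 1 := by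
  have h1 := orderOf_dvd_of_pow_eq_one h4
  have h2 := orderOf_dvd_of_pow_eq_one h
  have hc : Nat.Coprime 4 n := by
    have : Nat.Coprime 2 n := Nat.coprime_two_left.mpr hn
    exact Nat.Coprime.pow_left 2 this
  rw [← orderOf_eq_one_iff]
  exact Nat.eq_one_of_dvd_coprimes hc h1 h2

/-- An odd order automorphism of a 2-group fixing all elements of order dividing 4 is trivial. -/
theorem aux_four {P : Type*} [Group P] [Finite P] (hP : IsPGroup 2 P) (α : MulAut P)
    (n : ℕ) (hn : Odd n) (hα : α ^ n = 1) (h4 : ∀ x : P, x ^ 4 = 1 → α x = x) :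
    ∀ (N : ℕ) (H : Subgroup P), Nat.card H = N → (∀ x ∈ H, α x ∈ H) → ∀ x ∈ H, α x = x := by
  intro N
  induction N using Nat.strong_induction_on with
  | _ N ih =>
  intro H hHN hinv
  have hlt : ∀ L : Subgroup P, L < H → (∀ x ∈ L, α x ∈ L) → ∀ x ∈ L, α x = x := by
    intro L hL hLi
    refine ih _ ?_ L rfl hLi
    rw [← hHN]
    exact Set.Finite.card_lt_card (Set.toFinite _) hL
  -- key finishing
  have key : ∀ x, α (x⁻¹ * α x) = x⁻¹ * α x → (x⁻¹ * α x) ^ n = 1 := by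
    intro x h
    have h1 := aux_pow_mem α x (x⁻¹ * α x) (by group) h n
    rw [hα] at h1
    simpa using h1
  -- coprimality with n
  have cop : ∀ y : P, y ^ n = 1 → y = 1 := by
    intro y hy
    obtain ⟨k, hk⟩ := hP y
    have h1 := orderOf_dvd_of_pow_eq_one hk
    have h2 := orderOf_dvd_of_pow_eq_one hy
    rw [← orderOf_eq_one_iff]
    exact Nat.eq_one_of_dvd_coprimes (Nat.Coprime.pow_left k (Nat.coprime_two_left.mpr hn)) h1 h2
  have fin : ∀ x, α (x⁻¹ * α x) = x⁻¹ * α x → α x = x := by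
    intro x h
    have := cop _ (key x h)
    rw [inv_mul_eq_one] at this
    exact this.symm
  set L := Subgroup.closure {z | ∃ x ∈ H, z = x⁻¹ * α x} with hL
  have hLH : L ≤ H := by
    rw [hL, Subgroup.closure_le]
    rintro _ ⟨x, hx, rfl⟩
    exact H.mul_mem (H.inv_mem hx) (hinv x hx)
  have hLi : ∀ x ∈ L, α x ∈ L := by
    have : L ≤ L.comap α.toMonoidHom := by
      conv_lhs => rw [hL]
      rw [Subgroup.closure_le]
      rintro _ ⟨x, hx, rfl⟩
      refine Subgroup.subset_closure ⟨α x, hinv x hx, ?_⟩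
      simp
    exact this
  rcases hLH.lt_or_eq with hlt1 | heq
  · intro x hx
    exact fin x (hlt L hlt1 hLi _ (Subgroup.subset_closure ⟨x, hx, rfl⟩))
  set S := Subgroup.closure {z | ∃ x ∈ H, z = x ^ 2} with hS
  have hSi : ∀ x ∈ S, α x ∈ S := by
    have : S ≤ S.comap α.toMonoidHom := by
      conv_lhs => rw [hS]
      rw [Subgroup.closure_le]
      rintro _ ⟨x, hx, rfl⟩
      refine Subgroup.subset_closure ⟨α x, hinv x hx, ?_⟩
      simp
    exact this
  by_cases hbot : H = ⊥
  · intro x hx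
    rw [hbot, Subgroup.mem_bot] at hx
    simp [hx]
  have hSH : S < H := by
    obtain ⟨m, hm⟩ := (IsPGroup.iff_card (p := 2) (G := H)).mp (hP.to_subgroup H)
    have hm0 : m ≠ 0 := by
      rintro rfl
      exact hbot (Subgroup.card_eq_one.mp (by simpa using hm))
    obtain ⟨l, rfl⟩ := Nat.exists_eq_succ_of_ne_zero hm0
    obtain ⟨M, -, hMH, hM⟩ := aux_between ⊥ H 0 l (l+1) bot_le (by simp) hm (by omega) (by omega)
    have hi : (M.subgroupOf H).index = 2 := by
      have h1 := Subgroup.card_mul_index (M.subgroupOf H)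
      have h2 : Nat.card (M.subgroupOf H) = 2 ^ l := by
        rw [← hM]; exact Nat.card_congr (Subgroup.subgroupOfEquivOfLe hMH).toEquiv
      rw [h2, hm, Nat.succ_eq_add_one, pow_succ] at h1
      exact Nat.eq_of_mul_eq_mul_left (by positivity) h1
    have hSM : S ≤ M := by
      rw [hS, Subgroup.closure_le]
      rintro _ ⟨x, hx, rfl⟩
      exact Subgroup.sq_mem_of_index_two hi ⟨x, hx⟩
    refine lt_of_le_of_lt hSM (lt_of_le_of_ne hMH ?_)
    rintro rfl
    rw [hm] at hM
    have := Nat.pow_right_injective (le_refl 2) hM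
    omega
  have hSf := hlt S hSH hSi
  -- squares are centralised by H
  have hcent : ∀ g ∈ H, ∀ s ∈ S, g * s = s * g := by
    have hconj : ∀ x ∈ H, ∀ s ∈ S, x * s * x⁻¹ ∈ S := by
      intro x hx s hs
      induction hs using Subgroup.closure_induction with
      | mem s hs =>
        obtain ⟨z, hz, rfl⟩ := hs
        refine Subgroup.subset_closure ⟨x * z * x⁻¹, H.mul_mem (H.mul_mem hx hz) (H.inv_mem hx), ?_⟩
        simp [pow_two, mul_assoc]
      | one => simp [S.one_mem]
      | mul a b _ _ ha hb =>
        have := S.mul_mem ha hb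
        convert this using 1
        group
      | inv a _ ha =>
        have := S.inv_mem ha
        convert this using 1
        group
    intro g hg
    rw [← heq] at hg
    intro s hs
    have : L ≤ Subgroup.centralizer {s} := by
      rw [hL, Subgroup.closure_le]
      rintro _ ⟨x, hx, rfl⟩
      have h1 := hSf _ (hconj x hx s hs)
      rw [map_mul, map_mul, map_inv, hSf s hs] at h1
      rw [SetLike.mem_coe, Subgroup.mem_centralizer_singleton_iff]
      have h2 : α x * s = x * s * x⁻¹ * α x := by rw [← h1]; group
      calc x⁻¹ * α x * s = x⁻¹ * (α x * s) := by group
        _ = s * (x⁻¹ * α x) := by rw [h2]; group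
    exact (Subgroup.mem_centralizer_singleton_iff.mp (this hg))
  intro x hx
  apply fin
  apply h4
  set y := x⁻¹ * α x with hy
  have hyH : y ∈ H := H.mul_mem (H.inv_mem hx) (hinv x hx)
  have hxy : α x = x * y := by rw [hy]; group
  have hsq : ∀ z ∈ H, z ^ 2 ∈ S := fun z hz => Subgroup.subset_closure ⟨z, hz, rfl⟩
  have e1 : (x * y) ^ 2 = x ^ 2 := by
    rw [← hxy, ← map_pow]; exact hSf _ (hsq x hx)
  have e2 : y * x * y = x := by
    have : x * (y * x * y) = x * x := by
      rw [← pow_two x, ← e1, pow_two]; group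
    exact mul_left_cancel this
  have e3 : y = x * y⁻¹ * x⁻¹ := by
    have : x * y⁻¹ = y * x := by
      rw [mul_inv_eq_iff_eq_mul]; exact e2.symm
    rw [this]; group
  have e4 : y ^ 2 = x * (y ^ 2)⁻¹ * x⁻¹ := by
    have : y ^ 2 = (x * y⁻¹ * x⁻¹) ^ 2 := by rw [← e3]
    refine this.trans ?_
    simp [pow_two, mul_assoc]
  rw [hcent x hx _ (S.inv_mem (hsq y hyH))] at e4
  have e5 : y ^ 2 * y ^ 2 = 1 := by
    nth_rw 1 [e4]
    group
  rw [← e5]; group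

theorem aux_cyclic {P : Type*} [Group P] [Finite P] (hP : IsPGroup 2 P) (α : MulAut P)
    (n : ℕ) (hn : Odd n) (hα : α ^ n = 1) (y : P) (h : α y ∈ Subgroup.zpowers y) : α y = y := by
  classical
  rw [mem_zpowers_iff_mem_range_orderOf] at h
  obtain ⟨j, -, hj⟩ := Finset.mem_image.mp h
  have hi : ∀ i : ℕ, (α ^ i) y = y ^ (j ^ i) := by
    intro i
    induction i with
    | zero => simp
    | succ i ih => rw [pow_succ', MulAut.mul_apply, ih, map_pow, ← hj, ← pow_mul, pow_succ']
  have h1 := hi n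
  rw [hα, MulAut.one_apply] at h1
  have h2 : y ^ 1 = y ^ (j ^ n) := by simpa using h1
  rw [pow_eq_pow_iff_modEq] at h2
  obtain ⟨m, hm⟩ := (IsPGroup.iff_orderOf.mp hP) y
  rw [← ZMod.natCast_eq_natCast_iff] at h2
  push_cast at h2
  have hu : IsUnit (j : ZMod (orderOf y)) := IsUnit.of_pow_eq_one h2.symm (by rintro rfl; simp at hn)
  obtain ⟨u, hu⟩ := hu
  have hun : u ^ n = 1 := by
    ext; push_cast; rw [hu]; exact h2.symm
  have hut := ZMod.pow_totient u
  have hu1 : u = 1 := by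
    have a1 := orderOf_dvd_of_pow_eq_one hun
    have a2 := orderOf_dvd_of_pow_eq_one hut
    rw [← orderOf_eq_one_iff]
    refine Nat.eq_one_of_dvd_coprimes (a := n) (b := Nat.totient (orderOf y)) ?_ a1 a2
    rw [hm]
    rcases m with _ | m
    · simp
    · rw [Nat.totient_prime_pow Nat.prime_two (by omega)]
      simpa using Nat.Coprime.pow_right m (Nat.coprime_two_right.mpr hn)
  rw [hu1] at hu
  have h3 : j ≡ 1 [MOD orderOf y] := by
    rw [← ZMod.natCast_eq_natCast_iff, ← hu]; simp
  rw [← hj]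
  simpa using pow_eq_pow_iff_modEq.mpr h3

theorem aux_fix {P : Type*} [Group P] [Finite P] (α : MulAut P)
    (p : ℕ) (hp : p.Prime) (hα : α ^ p = 1) (S : Set P) (hS : ∀ x ∈ S, α x ∈ S)
    (hnf : ∀ x ∈ S, α x ≠ x) : p ∣ Nat.card S := by
  classical
  have := Fact.mk hp
  have := Fintype.ofFinite S
  let f : Function.End S := fun x => ⟨α x, hS x x.2⟩
  have hfi : ∀ (i : ℕ) (x : S), ((f ^ i) x : P) = (α ^ i) x := by
    intro i
    induction i with
    | zero => intro x; rfl
    | succ i ih =>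
      intro x
      rw [pow_succ', pow_succ', MulAut.mul_apply, ← ih]; rfl
  have hf : f ^ p ^ 1 = 1 := by
    funext x
    apply Subtype.ext
    rw [hfi, pow_one, hα]; rfl
  have := Equiv.Perm.card_fixedPoints_modEq hf
  have h0 : Fintype.card f.fixedPoints = 0 := by
    rw [Fintype.card_eq_zero_iff]
    exact ⟨fun x => hnf _ x.1.2 (congrArg Subtype.val x.2)⟩
  rw [h0] at this
  rw [Nat.card_eq_fintype_card]
  exact (Nat.modEq_zero_iff_dvd).mp this

theorem aux_noncyc {P : Type*} [Group P] [Finite P] (hP : IsPGroup 2 P) (α : MulAut P)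
    (p : ℕ) (hp : p.Prime) (hpo : Odd p) (hα : α ^ p = 1) (K : Subgroup P) (k : ℕ)
    (hK : Nat.card K = 2 ^ (k + 1)) (hnc : ∀ x ∈ K, Subgroup.zpowers x ≠ K)
    (hinv : ∀ H : Subgroup P, Nat.card H = 2 ^ k → ∀ x ∈ H, α x ∈ H) : ∀ x ∈ K, α x = x := by
  have hsub : ∀ C : Subgroup P, C < K → ∃ M, C ≤ M ∧ M ≤ K ∧ Nat.card M = 2 ^ k := by
    intro C hC
    obtain ⟨m, hm⟩ := (IsPGroup.iff_card (p := 2) (G := C)).mp (hP.to_subgroup C)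
    have hlt : Nat.card C < Nat.card K := Set.Finite.card_lt_card (Set.toFinite _) hC
    rw [hm, hK] at hlt
    have := (Nat.pow_lt_pow_iff_right (by norm_num : 1 < 2)).mp hlt
    exact aux_between C K m k (k+1) hC.le hm hK (by omega) (by omega)
  have hKi : ∀ x ∈ K, α x ∈ K := by
    intro x hx
    obtain ⟨M, h1, h2, h3⟩ := hsub (Subgroup.zpowers x)
      (lt_of_le_of_ne (by simpa using hx) (hnc x hx))
    exact h2 (hinv M h3 x (h1 (Subgroup.mem_zpowers x)))
  let C : Subgroup P := K ⊓ (MonoidHom.eqLocus α.toMonoidHom (MonoidHom.id P))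
  rcases (inf_le_left : C ≤ K).lt_or_eq with hC | hC
  · exfalso
    obtain ⟨M, h1, h2, h3⟩ := hsub C hC
    have hMi := hinv M h3
    have hMi' : ∀ x, α x ∈ M → x ∈ M := by
      have hpw : ∀ i : ℕ, ∀ x ∈ M, (α ^ i) x ∈ M := by
        intro i
        induction i with
        | zero => intro x hx; exact hx
        | succ i ih => intro x hx; rw [pow_succ', MulAut.mul_apply]; exact hMi _ (ih x hx)
      intro x hx
      have := hpw (p - 1) _ hx
      rwa [← MulAut.mul_apply, ← pow_succ, Nat.sub_add_cancel hp.one_le, hα] at this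
    have hd := aux_fix α p hp hα ((K : Set P) \ M) (fun x hx => ⟨hKi x hx.1, fun h => hx.2 (hMi' x h)⟩)
      (fun x hx h => hx.2 (h1 ⟨hx.1, h⟩))
    have hc : Nat.card ((K : Set P) \ M : Set P) = 2 ^ k := by
      have a := Set.ncard_sdiff_add_ncard_of_subset (show (M : Set P) ⊆ K from h2)
      have b : (M : Set P).ncard = 2 ^ k := h3
      have c : (K : Set P).ncard = 2 ^ (k + 1) := hK
      rw [b, c, pow_succ] at a
      rw [Nat.card_coe_set_eq]
      omega
    rw [hc] at hd
    have := hp.dvd_of_dvd_pow hd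
    rw [Nat.prime_dvd_prime_iff_eq hp Nat.prime_two] at this
    subst this
    exact absurd hpo (by decide)
  · intro x hx
    rw [← hC] at hx
    exact hx.2

theorem aux_main {P : Type*} [Group P] [Finite P] (hP : IsPGroup 2 P) (k : ℕ) (hk : 1 ≤ k)
    (hlt : 2 ^ k < Nat.card P) (n : ℕ) : ∀ (α : MulAut P), Odd n → α ^ n = 1 →
    (∀ H : Subgroup P, Nat.card H = 2 ^ k → ∀ x ∈ H, α x ∈ H) →
    (k = 1 → ∀ H : Subgroup P, Nat.card H = 4 → ∀ x ∈ H, α x ∈ H) → α = 1 := by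
  induction n using Nat.strong_induction_on with
  | _ n ih =>
  intro α hn hα hinv hinv4
  by_cases hn1 : n = 1
  · simpa [hn1] using hα
  have hp := Nat.minFac_prime hn1
  obtain ⟨q, hq⟩ := Nat.minFac_dvd n
  set p := n.minFac
  have hodd := hn
  rw [hq, Nat.odd_mul] at hodd
  have hpw : ∀ H : Subgroup P, (∀ x ∈ H, α x ∈ H) → ∀ i : ℕ, ∀ x ∈ H, (α ^ i) x ∈ H := by
    intro H hH i
    induction i with
    | zero => intro x hx; exact hx
    | succ i ih => intro x hx; rw [pow_succ', MulAut.mul_apply]; exact hH _ (ih x hx)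
  have hqn : q < n := by
    have : 0 < q := hodd.2.pos
    have := hp.two_le
    rw [hq]; nlinarith
  have hαp : α ^ p = 1 := ih q hqn (α ^ p) hodd.2 (by rw [← pow_mul, ← hq, hα])
    (fun H hH => hpw H (hinv H hH) p) (fun h1 H hH => hpw H (hinv4 h1 H hH) p)
  have hcyc : ∀ y : P, (∀ x ∈ Subgroup.zpowers y, α x ∈ Subgroup.zpowers y) →
      ∀ x ∈ Subgroup.zpowers y, α x = x := by
    intro y hy x hx
    have h1 := aux_cyclic hP α n hn hα y (hy y (Subgroup.mem_zpowers y))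
    obtain ⟨i, rfl⟩ := Subgroup.mem_zpowers_iff.mp hx
    rw [map_zpow, h1]
  have h4 : ∀ x : P, x ^ 4 = 1 → α x = x := by
    intro x hx
    have hd : orderOf x ∣ 2 ^ 2 := orderOf_dvd_of_pow_eq_one hx
    obtain ⟨m, hm2, hm⟩ := (Nat.dvd_prime_pow Nat.prime_two).mp hd
    have hcz : Nat.card (Subgroup.zpowers x) = 2 ^ m := by rw [Nat.card_zpowers, hm]
    by_cases hm0 : m = 0
    · have : x = 1 := by rw [← orderOf_eq_one_iff, hm, hm0, pow_zero]
      simp [this]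
    obtain ⟨t, ht⟩ := (IsPGroup.iff_card (p := 2) (G := P)).mp hP
    have hkt : k < t := by
      rw [ht] at hlt
      exact (Nat.pow_lt_pow_iff_right (by norm_num : 1 < 2)).mp hlt
    by_cases hmk : m ≤ k
    · obtain ⟨H, h1, -, h2⟩ := aux_between (Subgroup.zpowers x) ⊤ m k t le_top hcz
        (by simpa using ht) hmk hkt.le
      have hxH : x ∈ H := h1 (Subgroup.mem_zpowers x)
      by_cases hc : ∃ y, Subgroup.zpowers y = H
      · obtain ⟨y, rfl⟩ := hc
        exact hcyc y (hinv _ h2) x hxH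
      · obtain ⟨K, h3, -, h4⟩ := aux_between H ⊤ k (k+1) t le_top h2
          (by simpa using ht) (by omega) hkt
        refine aux_noncyc hP α p hp hodd.1 hαp K k h4 ?_ hinv x (h3 hxH)
        rintro y - rfl
        apply hc
        have hcH : IsCyclic H :=
          isCyclic_of_injective (Subgroup.inclusion h3) (Subgroup.inclusion_injective h3)
        exact (Subgroup.isCyclic_iff_exists_zpowers_eq_top H).mp hcH
    · have hk1 : k = 1 := by omega
      have hm' : m = 2 := by omega
      refine hcyc x (hinv4 hk1 _ (by rw [hcz, hm']; norm_num)) x (Subgroup.mem_zpowers x)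
  ext x
  exact aux_four hP α n hn hα h4 _ ⊤ rfl (fun _ _ => Subgroup.mem_top _) x (Subgroup.mem_top x)

theorem stmt5 {A P : Type*} [Group A] [Finite A] [Group P] [Finite P]
    (hA : Odd (Nat.card A)) (hP : IsPGroup 2 P) (φ : A →* MulAut P)
    (D : Subgroup P) (hD1 : 1 < Nat.card D) (hDlt : Nat.card D < Nat.card P)
    (hinv : ∀ H : Subgroup P, Nat.card H = Nat.card D →
      ∀ a : A, H.map (φ a).toMonoidHom = H)
    (hinv4 : Nat.card D = 2 → ∀ H : Subgroup P, Nat.card H = 4 →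
      ∀ a : A, H.map (φ a).toMonoidHom = H) :
    ∀ a : A, φ a = 1 := by
  intro a
  obtain ⟨k, hk⟩ := (IsPGroup.iff_card (p := 2) (G := D)).mp (hP.to_subgroup D)
  have hk1 : 1 ≤ k := by
    rcases k with _ | k
    · simp [hk] at hD1
    · omega
  refine aux_main hP k hk1 (hk ▸ hDlt) (Nat.card A) (φ a) hA ?_ ?_ ?_
  · rw [← map_pow, pow_card_eq_one', map_one]
  · intro H hH x hx
    have := hinv H (hH.trans hk.symm) a
    rw [← this]
    exact ⟨x, hx, rfl⟩
  · intro h1 H hH x hx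
    have := hinv4 (by rw [hk, h1, pow_one]) H hH a
    rw [← this]
    exact ⟨x, hx, rfl⟩
end

section
/- Let G be a finite group whose generalized Fitting subgroup is F*(G). Then the centralizer C_G(F*(G)) is contained in F*(G). -/
/-- `H` is subnormal in `G`. -/
def Subnormal {G : Type*} [Group G] (H : Subgroup G) : Prop :=
  ∃ (n : ℕ) (c : Fin (n + 1) → Subgroup G),
    c 0 = H ∧ c (Fin.last n) = ⊤ ∧
    ∀ i : Fin n, ∃ _ : c i.castSucc ≤ c i.succ,
      ((c i.castSucc).subgroupOf (c i.succ)).Normal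

/-- A group is quasisimple if it is perfect and its central quotient is simple. -/
def IsQuasisimple (H : Type*) [Group H] : Prop :=
  commutator H = ⊤ ∧ IsSimpleGroup (H ⧸ Subgroup.center H)

/-- The subgroup generated by the components (subnormal quasisimple subgroups). -/
def layer (G : Type*) [Group G] : Subgroup G :=
  ⨆ H ∈ {H : Subgroup G | Subnormal H ∧ IsQuasisimple H}, H

/-- The Fitting subgroup: the join of all nilpotent normal subgroups. -/
def fitting (G : Type*) [Group G] : Subgroup G :=
  ⨆ H ∈ {H : Subgroup G | H.Normal ∧ Group.IsNilpotent H}, H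

/-- The generalized Fitting subgroup `F*(G) = E(G) F(G)`. -/
def genFitting (G : Type*) [Group G] : Subgroup G :=
  layer G ⊔ fitting G

open Subgroup

theorem aux_subnormal_of {G : Type*} [Group G] {H : Subgroup G} (h : Subnormal H) :
    H.IsSubnormal := by
  obtain ⟨n, c, h0, h1, h2⟩ := h
  have key : ∀ j : Fin (n + 1), (c j).IsSubnormal := by
    intro j
    induction j using Fin.reverseInduction with
    | last => rw [h1]; exact IsSubnormal.top
    | cast i ih =>
      obtain ⟨hle, hn⟩ := h2 i
      exact IsSubnormal.step _ _ hle ih hn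
  rw [← h0]
  exact key 0

theorem aux_subnormal_to {G : Type*} [Group G] {H : Subgroup G} (h : H.IsSubnormal) :
    Subnormal H := by
  obtain ⟨n, f, hm, hn, h0, h1⟩ := IsSubnormal.isSubnormal_iff.mp h
  refine ⟨n, fun i => f i, by simpa using h0, by simpa using h1, fun i => ⟨?_, ?_⟩⟩
  · exact hm (by simp)
  · simpa using hn i

theorem aux_quasi {H K : Type*} [Group H] [Group K] (e : H ≃* K) (h : IsQuasisimple H) :
    IsQuasisimple K := by
  obtain ⟨h1, h2⟩ := h
  refine ⟨?_, ?_⟩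
  · have := congrArg (Subgroup.map (e : H →* K)) h1
    rw [commutator_def, map_commutator] at this
    rw [commutator_def]
    rwa [Subgroup.map_top_of_surjective (e : H →* K) e.surjective] at this
  · have he : (center H).map (e : H →* K) = center K := by
      ext x
      simp only [mem_map, mem_center_iff, MonoidHom.coe_coe]
      constructor
      · rintro ⟨y, hy, rfl⟩ g
        obtain ⟨g, rfl⟩ := e.surjective g
        rw [← map_mul, ← map_mul, hy]
      · intro hx
        refine ⟨e.symm x, fun g => e.injective ?_, by simp⟩
        simpa using hx (e g)
    exact (QuotientGroup.congr _ _ e he).isSimpleGroup_congr.mp h2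

theorem aux_layer_normal (G : Type*) [Group G] : (layer G).Normal := by
  refine normalizer_eq_top_iff.mp (eq_top_iff.mpr fun g _ => ?_)
  have key : ∀ g : G, (layer G).map (MulAut.conj g : G →* G) ≤ layer G := by
    intro g
    simp only [layer, Subgroup.map_iSup]
    refine iSup₂_le fun H hH => ?_
    refine le_iSup₂_of_le (H.map (MulAut.conj g : G →* G)) ⟨?_, ?_⟩ le_rfl
    · exact aux_subnormal_to ((aux_subnormal_of hH.1).map (MulAut.conj g).surjective)
    · exact aux_quasi (H.equivMapOfInjective _ (MulAut.conj g).injective) hH.2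
  rw [mem_normalizer_iff]
  intro h
  constructor
  · intro hh
    exact key g ⟨h, hh, by simp⟩
  · intro hh
    exact key g⁻¹ ⟨_, hh, by simp [mul_assoc]⟩

theorem aux_genFitting_normal (G : Type*) [Group G] : (genFitting G).Normal := by
  have := aux_layer_normal G
  have : (fitting G).Normal := biSup_normal _ _ fun H hH => hH.1
  exact sup_normal _ _

theorem aux_sup_solvable {G : Type*} [Group G] (A B : Subgroup G) (hle : A ≤ normalizer B)
    (hA : Group.IsSolvable A) (hB : Group.IsSolvable B) :
    Group.IsSolvable (A ⊔ B : Subgroup G) := by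
  have := Subgroup.normal_subgroupOf_of_le_normalizer hle
  have := Subgroup.normal_subgroupOf_sup_of_le_normalizer hle
  rw [Group.isSolvable_iff_subgroup_quotient (B.subgroupOf (A ⊔ B))]
  constructor
  · exact Group.isSolvable_of_isSolvable_injective
      (f := (subgroupOfEquivOfLe (le_sup_right : B ≤ A ⊔ B)).toMonoidHom)
      (subgroupOfEquivOfLe (le_sup_right : B ≤ A ⊔ B)).injective
  · exact Group.isSolvable_of_surjective
      (f := (QuotientGroup.quotientInfEquivProdNormalizerQuotient A B hle).toMonoidHom)
      (QuotientGroup.quotientInfEquivProdNormalizerQuotient A B hle).surjective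

theorem aux_solv {G : Type*} [Group G] [Finite G] {K : Subgroup G} (hK : K.IsSubnormal) :
    ∀ P : Subgroup G, P ≤ K → K ≤ normalizer P → Group.IsSolvable P →
      ∃ R : Subgroup G, R.Normal ∧ Group.IsSolvable R ∧ P ≤ R := by
  induction hK with
  | top =>
    intro P _ hn hs
    exact ⟨P, normalizer_eq_top_iff.mp (top_le_iff.mp hn), hs, le_rfl⟩
  | step H K hHK _ hN ih =>
    intro P hP hn hs
    rw [normal_subgroupOf_iff_le_normalizer hHK] at hN
    obtain ⟨S, hPS, hS⟩ := exists_maximal_ge_of_wellFoundedGT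
      (fun S : Subgroup G => S ≤ H ∧ H ≤ normalizer S ∧ Group.IsSolvable S) P ⟨hP, hn, hs⟩
    obtain ⟨⟨hSH, hHS, hSs⟩, hmax⟩ := hS
    have key : ∀ k ∈ K, S.map (MulAut.conj k : G →* G) ≤ S := by
      intro k hk
      have hHk : H.map (MulAut.conj k : G →* G) = H := mem_normalizer_iff_map_conj_eq.mp (hN hk)
      have h1 : S.map (MulAut.conj k : G →* G) ≤ H := (map_mono hSH).trans hHk.le
      have h2 : H ≤ normalizer (S.map (MulAut.conj k : G →* G)) :=
        hHk.ge.trans ((map_mono hHS).trans (le_normalizer_map _))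
      have h3 : Group.IsSolvable (S.map (MulAut.conj k : G →* G)) :=
        Group.isSolvable_of_surjective
          (f := (S.equivMapOfInjective _ (MulAut.conj k).injective).toMonoidHom)
          (S.equivMapOfInjective _ (MulAut.conj k).injective).surjective
      refine le_sup_left.trans (hmax (y := S.map (MulAut.conj k : G →* G) ⊔ S) ⟨sup_le h1 hSH, ?_,
        aux_sup_solvable _ _ (h1.trans hHS) h3 hSs⟩ le_sup_right)
      intro x hx
      rw [mem_normalizer_iff_map_conj_eq, Subgroup.map_sup,
        mem_normalizer_iff_map_conj_eq.mp (h2 hx), mem_normalizer_iff_map_conj_eq.mp (hHS hx)]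
    obtain ⟨R, hR, hRs, hSR⟩ := ih S (hSH.trans hHK) (by
      intro k hk
      rw [mem_normalizer_iff]
      intro h
      constructor
      · intro hh
        exact key k hk ⟨h, hh, by simp⟩
      · intro hh
        exact key k⁻¹ (inv_mem hk) ⟨_, hh, by simp [mul_assoc]⟩) hSs
    exact ⟨R, hR, hRs, hPS.trans hSR⟩

theorem aux_nilp {H : Type*} [Group H] (h : commutator H ≤ center H) : Group.IsNilpotent H :=
  _root_.isNilpotent_of_ker_le_center (Abelianization.of (G := H)) (by rwa [Abelianization.ker_of])

theorem aux_central {G : Type*} [Group G] {K N : Subgroup G}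
    (hK : K ≤ centralizer (genFitting G : Set G)) (hN : N ≤ genFitting G) :
    N.subgroupOf K ≤ center K := by
  intro x hx
  rw [mem_center_iff]
  intro g
  have := mem_centralizer_iff.mp (hK g.2) _ (hN hx)
  exact Subtype.ext this.symm

theorem aux_comm_sub {G : Type*} [Group G] (K : Subgroup G) :
    (⁅K, K⁆).subgroupOf K = commutator K := by
  apply Subgroup.map_injective K.subtype_injective
  rw [map_subtype_commutator, map_subgroupOf_eq_of_le (commutator_le_self K)]

/-- no normal solvable subgroup of the centralizer escapes -/
theorem aux_normal_solv {G : Type*} [Group G] [Finite G] (M₀ : Subgroup G) (hn : M₀.Normal)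
    (hs : Group.IsSolvable M₀) (hC : M₀ ≤ centralizer (genFitting G : Set G)) :
    M₀ ≤ genFitting G := by
  by_contra hcon
  obtain ⟨M, ⟨hMn, hMs, hMC, hMF⟩, hmin⟩ := exists_minimal_of_wellFoundedLT
    (fun M : Subgroup G => M.Normal ∧ Group.IsSolvable M ∧
      M ≤ centralizer (genFitting G : Set G) ∧ ¬ M ≤ genFitting G) ⟨M₀, hn, hs, hC, hcon⟩
  have hle : ⁅M, M⁆ ≤ M := commutator_le_self M
  have hF : ⁅M, M⁆ ≤ genFitting G := by
    by_contra hF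
    have h1 : M ≤ ⁅M, M⁆ := hmin (y := ⁅M, M⁆) ⟨inferInstance,
      Group.isSolvable_of_isSolvable_injective (inclusion_injective hle), hle.trans hMC, hF⟩ hle
    have : Group.IsPerfect M := isPerfect_iff.mpr (le_antisymm hle h1)
    have : Nontrivial M := by
      rw [nontrivial_iff_ne_bot]
      rintro rfl
      exact hMF bot_le
    exact Group.IsPerfect.not_isSolvable M hMs
  have hnil : Group.IsNilpotent M := aux_nilp (by
    rw [← aux_comm_sub]; exact aux_central hMC hF)
  exact hMF (le_sup_of_le_right (le_iSup₂_of_le M ⟨hMn, hnil⟩ le_rfl))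

theorem stmt16 {G : Type*} [Group G] [Finite G] :
    Subgroup.centralizer (genFitting G : Set G) ≤ genFitting G := by
  by_contra hcon
  have := aux_genFitting_normal G
  obtain ⟨K, ⟨hKs, hKC, hKF⟩, hmin⟩ := exists_minimal_of_wellFoundedLT
    (fun K : Subgroup G => K.IsSubnormal ∧ K ≤ centralizer (genFitting G : Set G) ∧
      ¬ K ≤ genFitting G)
    ⟨_, Normal.isSubnormal (normal_centralizer (H := genFitting G)), le_rfl, hcon⟩
  have key : ∀ N : Subgroup K, N.Normal → N = ⊤ ∨ N ≤ center K := by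
    intro N hN
    by_cases h : N.map K.subtype ≤ genFitting G
    · right
      have := aux_central hKC h
      rwa [subgroupOf, comap_map_eq_self_of_injective K.subtype_injective] at this
    · left
      have h1 := hmin (y := N.map K.subtype)
        ⟨hN.isSubnormal.trans' hKs, (map_subtype_le N).trans hKC, h⟩ (map_subtype_le N)
      refine eq_top_iff.mpr fun x _ => ?_
      obtain ⟨y, hy, hyx⟩ := h1 x.2
      rwa [← Subtype.ext hyx]
  rcases key (commutator K) inferInstance with hp | hz
  · -- component
    have hc : center K ≠ ⊤ := by
      intro hc
      have : Group.IsPerfect K := ⟨hp⟩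
      have : Nontrivial K := by
        rw [nontrivial_iff_ne_bot]
        rintro rfl
        exact hKF bot_le
      exact Group.IsPerfect.not_isNilpotent K (aux_nilp (H := K) (hc ▸ le_top))
    have hq : IsQuasisimple K := by
      refine ⟨hp, ?_⟩
      have : Nontrivial (K ⧸ center K) := QuotientGroup.nontrivial_iff.mpr hc
      refine ⟨fun N hN => ?_⟩
      have hs := QuotientGroup.mk'_surjective (center K)
      rcases key (N.comap (QuotientGroup.mk' (center K))) (hN.comap _) with h | h
      · right
        rw [← map_comap_eq_self_of_surjective hs N, h, map_top_of_surjective _ hs]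
      · left
        rw [← map_comap_eq_self_of_surjective hs N, Subgroup.map_eq_bot_iff,
          QuotientGroup.ker_mk']
        exact h
    exact hKF (le_sup_of_le_left (le_iSup₂_of_le K ⟨aux_subnormal_to hKs, hq⟩ le_rfl))
  · have : Group.IsNilpotent K := aux_nilp hz
    obtain ⟨R, hR, hRs, hKR⟩ := aux_solv hKs K le_rfl le_normalizer inferInstance
    have := hR
    have := aux_normal_solv (R ⊓ centralizer (genFitting G : Set G))
      (normal_inf_normal _ _)
      (Group.isSolvable_of_isSolvable_injective (inclusion_injective inf_le_left)) inf_le_right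
    exact hKF ((le_inf hKR hKC).trans this)
end
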